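/- Let A, B ∈ ℂ^{n₁×n₁×n₃} with A ⋆ B = B ⋆ A, let k = max{ind(A), ind(B)}, and let A^{GD} and B^{GD} be GD inverses of A and B satisfying the GD equations with exponent k. If B ⋆ B^{GD} ⋆ A^{GD} = A^{GD} ⋆ B ⋆ B^{GD}, then B^{GD} ⋆ A^{GD} is a GD inverse of A ⋆ B with exponent k; that is, (A⋆B) ⋆ (B^{GD}⋆A^{GD}) ⋆ (A⋆B) = A⋆B, (B^{GD}⋆A^{GD}) ⋆ (A⋆B)^{k+1} = (A⋆B)^k, and (A⋆B)^{k+1} ⋆ (B^{GD}⋆A^{GD}) = (A⋆B)^k. -/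

import Mathlib

open Matrix BigOperators

/-- A third-order complex tensor in `ℂ^{n₁ × n₂ × n₃}`, given by its frontal slices. -/
abbrev Tensor3 (n₁ n₂ n₃ : ℕ) := Fin n₃ → Matrix (Fin n₁) (Fin n₂) ℂ

/-- Mode-3 product of a tensor with an `n₃ × n₃` matrix: the slices of the result are the
indicated linear combinations of the slices of `A`. -/
noncomputable def mode3 {n₁ n₂ n₃ : ℕ} (M : Matrix (Fin n₃) (Fin n₃) ℂ) (A : Tensor3 n₁ n₂ n₃) :
    Tensor3 n₁ n₂ n₃ :=
  fun i => ∑ j, M i j • A j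

/-- The M-product `A ⋆_M B`: slice-wise matrix product in the transformed (hat) domain,
transformed back by `M⁻¹`. -/
noncomputable def mprod {n₁ n₂ l n₃ : ℕ} (M : Matrix (Fin n₃) (Fin n₃) ℂ)
    (A : Tensor3 n₁ n₂ n₃) (B : Tensor3 n₂ l n₃) : Tensor3 n₁ l n₃ :=
  mode3 M⁻¹ (fun i => mode3 M A i * mode3 M B i)

/-- The identity tensor: every slice of its mode-3 transform is the identity matrix. -/
noncomputable def idT (n₁ : ℕ) {n₃ : ℕ} (M : Matrix (Fin n₃) (Fin n₃) ℂ) : Tensor3 n₁ n₁ n₃ :=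
  mode3 M⁻¹ (fun _ => (1 : Matrix (Fin n₁) (Fin n₁) ℂ))

/-- Powers of a square tensor with respect to the M-product. -/
noncomputable def mpow {n₁ n₃ : ℕ} (M : Matrix (Fin n₃) (Fin n₃) ℂ) (A : Tensor3 n₁ n₁ n₃) :
    ℕ → Tensor3 n₁ n₁ n₃
  | 0 => idT n₁ M
  | k + 1 => mprod M (mpow M A k) A

/-- Conjugate transpose with respect to the M-product: slice-wise conjugate transpose in the
transformed domain. -/
noncomputable def ctrans {n₁ n₂ n₃ : ℕ} (M : Matrix (Fin n₃) (Fin n₃) ℂ) (A : Tensor3 n₁ n₂ n₃) :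
    Tensor3 n₂ n₁ n₃ :=
  mode3 M⁻¹ (fun i => (mode3 M A i)ᴴ)

/-- Index of a square complex matrix: the least `k ≥ 0` with `rank(B^k) = rank(B^{k+1})`. -/
noncomputable def matIndex {n : ℕ} (B : Matrix (Fin n) (Fin n) ℂ) : ℕ :=
  sInf {k : ℕ | (B ^ k).rank = (B ^ (k + 1)).rank}

/-- Index of a tensor: the maximum of the indices of the slices of its mode-3 transform. -/
noncomputable def tIndex {n₁ n₃ : ℕ} (M : Matrix (Fin n₃) (Fin n₃) ℂ)
    (A : Tensor3 n₁ n₁ n₃) : ℕ :=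
  Finset.univ.sup fun i => matIndex (mode3 M A i)

/-- `X` is a GD inverse of `A` with exponent `k`:
`A ⋆ X ⋆ A = A`, `X ⋆ A^{k+1} = A^k`, `A^{k+1} ⋆ X = A^k`. -/
def IsGD {n₁ n₃ : ℕ} (M : Matrix (Fin n₃) (Fin n₃) ℂ) (A X : Tensor3 n₁ n₁ n₃)
    (k : ℕ) : Prop :=
  mprod M (mprod M A X) A = A ∧
  mprod M X (mpow M A (k + 1)) = mpow M A k ∧
  mprod M (mpow M A (k + 1)) X = mpow M A k

/-- `X` is the Drazin inverse of `A` with exponent `k`. -/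
def IsDrazin {n₁ n₃ : ℕ} (M : Matrix (Fin n₃) (Fin n₃) ℂ) (A X : Tensor3 n₁ n₁ n₃)
    (k : ℕ) : Prop :=
  mprod M X (mpow M A (k + 1)) = mpow M A k ∧
  mprod M (mprod M X A) X = X ∧
  mprod M X A = mprod M A X

/-- `X` is the Moore–Penrose inverse of `A`. -/
def IsMP {n₁ n₃ : ℕ} (M : Matrix (Fin n₃) (Fin n₃) ℂ) (A X : Tensor3 n₁ n₁ n₃) : Prop :=
  mprod M (mprod M A X) A = A ∧
  mprod M (mprod M X A) X = X ∧
  ctrans M (mprod M A X) = mprod M A X ∧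
  ctrans M (mprod M X A) = mprod M X A

theorem mode3_mode3 {n₁ n₂ n₃ : ℕ} (M N : Matrix (Fin n₃) (Fin n₃) ℂ) (A : Tensor3 n₁ n₂ n₃) :
    mode3 M (mode3 N A) = mode3 (M * N) A := by
  funext i
  simp only [mode3, Matrix.mul_apply, Finset.smul_sum, Finset.sum_smul, smul_smul]
  exact Finset.sum_comm

theorem mode3_one {n₁ n₂ n₃ : ℕ} (A : Tensor3 n₁ n₂ n₃) : mode3 1 A = A := by
  funext i
  simp [mode3, Matrix.one_apply]

section Transform

variable {n₁ n₂ n₃ : ℕ} {M : Matrix (Fin n₃) (Fin n₃) ℂ}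

theorem mode3_mode3_inv (hM : IsUnit M) (A : Tensor3 n₁ n₂ n₃) :
    mode3 M (mode3 M⁻¹ A) = A := by
  rw [mode3_mode3, Matrix.mul_nonsing_inv M ((Matrix.isUnit_iff_isUnit_det M).mp hM), mode3_one]

theorem mode3_injective (hM : IsUnit M) :
    Function.Injective (mode3 M : Tensor3 n₁ n₂ n₃ → Tensor3 n₁ n₂ n₃) :=
  Function.LeftInverse.injective (g := mode3 M⁻¹) fun A => by
    rw [mode3_mode3, Matrix.nonsing_inv_mul M ((Matrix.isUnit_iff_isUnit_det M).mp hM), mode3_one]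

theorem mode3_mprod (hM : IsUnit M) (A B : Tensor3 n₁ n₁ n₃) :
    mode3 M (mprod M A B) = mode3 M A * mode3 M B :=
  mode3_mode3_inv hM _

theorem mode3_mpow (hM : IsUnit M) (A : Tensor3 n₁ n₁ n₃) (k : ℕ) :
    mode3 M (mpow M A k) = mode3 M A ^ k := by
  induction k with
  | zero => exact mode3_mode3_inv hM _
  | succ k ih => rw [mpow, mode3_mprod hM, ih, pow_succ]

theorem isGD_iff (hM : IsUnit M) (A X : Tensor3 n₁ n₁ n₃) (k : ℕ) :
    IsGD M A X k ↔
      mode3 M A * mode3 M X * mode3 M A = mode3 M A ∧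
      mode3 M X * mode3 M A ^ (k + 1) = mode3 M A ^ k ∧
      mode3 M A ^ (k + 1) * mode3 M X = mode3 M A ^ k := by
  rw [IsGD, ← (mode3_injective hM).eq_iff (b := A), ← (mode3_injective hM).eq_iff (b := mpow M A k),
    ← (mode3_injective hM).eq_iff (b := mpow M A k)]
  simp only [mode3_mprod hM, mode3_mpow hM]

end Transform

section Monoid

variable {R : Type*} [Monoid R] {a b x y : R}

theorem mul_mul_mul_mul_eq_of_commute (hab : Commute a b) (ha : a * x * a = a)
    (hb : b * y * b = b) (h : b * y * x = x * b * y) :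
    a * b * (y * x) * (a * b) = a * b :=
  calc
    a * b * (y * x) * (a * b) = a * (b * y * x) * (a * b) := by simp only [mul_assoc]
    _ = a * x * (b * y * b) * a := by rw [h, hab.eq]; simp only [mul_assoc]
    _ = a * x * a * b := by rw [hb, mul_assoc, ← hab.eq, ← mul_assoc]
    _ = a * b := by rw [ha]

theorem mul_mul_mul_pow_succ_of_commute {k : ℕ} (hab : Commute a b)
    (ha : x * a ^ (k + 1) = a ^ k) (hb : y * b ^ (k + 1) = b ^ k) :
    y * x * (a * b) ^ (k + 1) = (a * b) ^ k := by
  rw [hab.mul_pow, hab.mul_pow, mul_assoc, ← mul_assoc x, ha, (hab.pow_pow k (k + 1)).eq,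
    ← mul_assoc, hb, (hab.pow_pow k k).eq]

theorem mul_pow_succ_mul_mul_of_commute {k : ℕ} (hab : Commute a b)
    (ha : a ^ (k + 1) * x = a ^ k) (hb : b ^ (k + 1) * y = b ^ k) :
    (a * b) ^ (k + 1) * (y * x) = (a * b) ^ k := by
  rw [hab.mul_pow, hab.mul_pow, mul_assoc, ← mul_assoc (b ^ (k + 1)), hb, ← mul_assoc,
    (hab.pow_pow (k + 1) k).eq, mul_assoc, ha, (hab.pow_pow k k).eq]

end Monoid

/-- reverse order law for the GD inverse under commutativity `A ⋆ B = B ⋆ A`. -/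
theorem gd_reverse_order_law_two {n₁ n₃ : ℕ} (hn₁ : 0 < n₁) (hn₃ : 0 < n₃)
    (M : Matrix (Fin n₃) (Fin n₃) ℂ) (hM : IsUnit M)
    (A B AGD BGD : Tensor3 n₁ n₁ n₃) (k : ℕ)
    (hcomm : mprod M A B = mprod M B A)
    (hk : k = max (tIndex M A) (tIndex M B))
    (hAGD : IsGD M A AGD k) (hBGD : IsGD M B BGD k)
    (h1 : mprod M (mprod M B BGD) AGD = mprod M (mprod M AGD B) BGD) :
    IsGD M (mprod M A B) (mprod M BGD AGD) k := by
  rw [isGD_iff hM] at hAGD hBGD ⊢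
  obtain ⟨ha₁, ha₂, ha₃⟩ := hAGD
  obtain ⟨hb₁, hb₂, hb₃⟩ := hBGD
  have hab : Commute (mode3 M A) (mode3 M B) := by
    simpa only [mode3_mprod hM, commute_iff_eq] using congrArg (mode3 M) hcomm
  have h := congrArg (mode3 M) h1
  simp only [mode3_mprod hM] at h ⊢
  exact ⟨mul_mul_mul_mul_eq_of_commute hab ha₁ hb₁ h,
    mul_mul_mul_pow_succ_of_commute hab ha₂ hb₂, mul_pow_succ_mul_mul_of_commute hab ha₃ hb₃⟩
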